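/- Under the Setup, and assuming the factorization of (q, id_𝟙) is obtained by choosing a cylinder object j̄ = (j̄₁, j̄₂): 𝟙̃ ⊔ 𝟙̃ → C̄ for 𝟙̃ in M and letting C be the pushout of j̄₂ along q: an object X is fibrant in M̃ if and only if X is fibrant in M and every map 𝟙̃ → X is homotopic in M to a map which factors through q: 𝟙̃ → 𝟙. Moreover, this last factorization property holds for one cofibrant resolution of the tensor unit if and only if it holds for every cofibrant resolution. -/

import Mathlib

open CategoryTheory CategoryTheory.Limits MonoidalCategory

universe v u v' u'

namespace Muro

variable {C : Type u} [Category.{v} C]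

/-- `f` is a retract of `g` in the arrow category. -/
structure IsRetractOfArrow {X Y X' Y' : C} (f : X ⟶ Y) (g : X' ⟶ Y') : Prop where
  intro ::
  nonempty : ∃ (i : X ⟶ X') (r : X' ⟶ X) (i' : Y ⟶ Y') (r' : Y' ⟶ Y),
    i ≫ r = 𝟙 X ∧ i' ≫ r' = 𝟙 Y ∧ i ≫ g = f ≫ i' ∧ r ≫ f = g ≫ r'

/-- A model structure on a category `C`: weak equivalences, cofibrations and
fibrations, subject to the usual axioms (2-out-of-3, closure under retracts,
lifting and factorization). -/
structure ModelStructure (C : Type u) [Category.{v} C] where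
  W : MorphismProperty C
  Cof : MorphismProperty C
  Fib : MorphismProperty C
  W_id : ∀ X : C, W (𝟙 X)
  W_comp : ∀ ⦃X Y Z : C⦄ (f : X ⟶ Y) (g : Y ⟶ Z), W f → W g → W (f ≫ g)
  W_of_comp_left : ∀ ⦃X Y Z : C⦄ (f : X ⟶ Y) (g : Y ⟶ Z), W f → W (f ≫ g) → W g
  W_of_comp_right : ∀ ⦃X Y Z : C⦄ (f : X ⟶ Y) (g : Y ⟶ Z), W g → W (f ≫ g) → W f
  W_retract : ∀ ⦃X Y X' Y' : C⦄ (f : X ⟶ Y) (g : X' ⟶ Y'),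
    IsRetractOfArrow f g → W g → W f
  Cof_retract : ∀ ⦃X Y X' Y' : C⦄ (f : X ⟶ Y) (g : X' ⟶ Y'),
    IsRetractOfArrow f g → Cof g → Cof f
  Fib_retract : ∀ ⦃X Y X' Y' : C⦄ (f : X ⟶ Y) (g : X' ⟶ Y'),
    IsRetractOfArrow f g → Fib g → Fib f
  lift_cof_trivFib : ∀ ⦃A B X Y : C⦄ (i : A ⟶ B) (p : X ⟶ Y),
    Cof i → Fib p → W p → HasLiftingProperty i p
  lift_trivCof_fib : ∀ ⦃A B X Y : C⦄ (i : A ⟶ B) (p : X ⟶ Y),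
    Cof i → W i → Fib p → HasLiftingProperty i p
  factor_cof_trivFib : ∀ ⦃X Y : C⦄ (f : X ⟶ Y),
    ∃ (Z : C) (i : X ⟶ Z) (p : Z ⟶ Y), Cof i ∧ Fib p ∧ W p ∧ i ≫ p = f
  factor_trivCof_fib : ∀ ⦃X Y : C⦄ (f : X ⟶ Y),
    ∃ (Z : C) (i : X ⟶ Z) (p : Z ⟶ Y), Cof i ∧ W i ∧ Fib p ∧ i ≫ p = f

/-- Trivial fibrations. -/
def ModelStructure.TrivFib (M : ModelStructure C) : MorphismProperty C :=
  fun _ _ f => M.Fib f ∧ M.W f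

/-- Trivial cofibrations. -/
def ModelStructure.TrivCof (M : ModelStructure C) : MorphismProperty C :=
  fun _ _ f => M.Cof f ∧ M.W f

section Initial

variable [HasInitial C]

/-- An object is cofibrant if the map from the initial object is a cofibration. -/
def ModelStructure.Cofibrant (M : ModelStructure C) (X : C) : Prop :=
  M.Cof (initial.to X)

end Initial

section Terminal

variable [HasTerminal C]

/-- An object is fibrant if the map to the terminal object is a fibration. -/
def ModelStructure.Fibrant (M : ModelStructure C) (X : C) : Prop :=
  M.Fib (terminal.from X)

end Terminal

section Monoidal

variable [MonoidalCategory C] [HasPushouts C]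

/-- The push-out product `f ⊙ g : X⊗V ∪_{X⊗U} Y⊗U ⟶ Y⊗V` of `f : X ⟶ Y` and
`g : U ⟶ V`. -/
noncomputable def pushoutProduct {X Y U V : C} (f : X ⟶ Y) (g : U ⟶ V) :
    pushout (X ◁ g) (f ▷ U) ⟶ Y ⊗ V :=
  pushout.desc (f ▷ V) (Y ◁ g) (whisker_exchange f g)

/-- The push-out product axiom of a monoidal model category. -/
def PushoutProductAxiom (M : ModelStructure C) : Prop :=
  (∀ ⦃X Y U V : C⦄ (f : X ⟶ Y) (g : U ⟶ V),
    M.Cof f → M.Cof g → M.Cof (pushoutProduct f g)) ∧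
  (∀ ⦃X Y U V : C⦄ (f : X ⟶ Y) (g : U ⟶ V),
    M.Cof f → M.W f → M.Cof g → M.W (pushoutProduct f g)) ∧
  (∀ ⦃X Y U V : C⦄ (f : X ⟶ Y) (g : U ⟶ V),
    M.Cof f → M.Cof g → M.W g → M.W (pushoutProduct f g))

variable [HasInitial C]

/-- `q : T ⟶ 𝟙` is a cofibrant resolution of the tensor unit: a weak
equivalence with cofibrant source. -/
def IsCofibrantResolutionOfUnit (M : ModelStructure C) {T : C} (q : T ⟶ 𝟙_ C) : Prop :=
  M.Cofibrant T ∧ M.W q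

/-- The unit axiom of a monoidal model category: there is a cofibrant resolution
`q : 𝟙̃ ⟶ 𝟙` of the tensor unit such that `q ⊗ X` and `X ⊗ q` are weak
equivalences for every cofibrant `X`. -/
def UnitAxiom (M : ModelStructure C) : Prop :=
  ∃ (T : C) (q : T ⟶ 𝟙_ C), IsCofibrantResolutionOfUnit M q ∧
    ∀ X : C, M.Cofibrant X → M.W (q ▷ X) ∧ M.W (X ◁ q)

/-- The very strong unit axiom for a cofibrant resolution `q : 𝟙̃ ⟶ 𝟙` of the
tensor unit: `q ⊗ X` and `X ⊗ q` are weak equivalences for *every* object `X`. -/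
def VeryStrongUnitAxiom (M : ModelStructure C) {T : C} (q : T ⟶ 𝟙_ C) : Prop :=
  ∀ X : C, M.W (q ▷ X) ∧ M.W (X ◁ q)

/-- A monoidal model category: a model structure together with a monoidal
structure satisfying the push-out product axiom and the unit axiom. -/
structure MonoidalModel (C : Type u) [Category.{v} C] [MonoidalCategory C]
    [HasInitial C] [HasPushouts C] extends ModelStructure C where
  ppAxiom : PushoutProductAxiom toModelStructure
  unitAxiom : UnitAxiom toModelStructure

/-- A map `f : X ⟶ Y` is surjective if the induced map
`M(𝟙, X) ⟶ M(𝟙, Y)` on hom-sets out of the tensor unit is surjective. -/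
def SurjectiveOnUnit {X Y : C} (f : X ⟶ Y) : Prop :=
  Function.Surjective (fun g : 𝟙_ C ⟶ X => g ≫ f)

end Monoidal

end Muro

namespace Muro

/-- A well-ordered index for transfinite compositions: a well-ordered set with
a bottom element and successors. -/
class WellOrderData (J : Type v) extends LinearOrder J, OrderBot J, SuccOrder J where
  wfLT : WellFoundedLT J

attribute [instance] WellOrderData.wfLT

variable {C : Type u} [Category.{v} C]

section Sequences

variable {J : Type v} [Preorder J]

/-- The inclusion functor `Set.Iio j ⥤ J`. -/
def iioFunctor (j : J) : Set.Iio j ⥤ J :=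
  Monotone.functor (f := fun i : Set.Iio j => (i : J)) (fun _ _ h => h)

/-- Restriction of `F : J ⥤ C` to `Set.Iio j`. -/
def restrictionLT (F : J ⥤ C) (j : J) : Set.Iio j ⥤ C :=
  iioFunctor j ⋙ F

/-- The cocone on `restrictionLT F j` with apex `F.obj j`. -/
@[simps]
def coconeLT (F : J ⥤ C) (j : J) : Cocone (restrictionLT F j) where
  pt := F.obj j
  ι :=
    { app := fun i => F.map (homOfLE i.2.le)
      naturality := fun i₁ i₂ φ => by
        dsimp [restrictionLT, iioFunctor, Monotone.functor]
        rw [Category.comp_id, ← F.map_comp]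
        congr 1 }

end Sequences

section TransfiniteComposition

variable (K : MorphismProperty C)

/-- A witness that `f : X ⟶ Y` is a transfinite composition, indexed by the
well-ordered set `J`, of maps in `K`: a smooth (i.e. continuous at limit
elements) `J`-indexed sequence starting at `X`, whose successor maps lie in
`K` and whose colimit is `Y`, the composition of the sequence being `f`. -/
structure TransfiniteCompositionOfShape (J : Type v) [WellOrderData J]
    {X Y : C} (f : X ⟶ Y) where
  F : J ⥤ C
  isoBot : F.obj ⊥ ≅ X
  step : ∀ j : J, ¬ IsMax j → K (F.map (homOfLE (Order.le_succ j)))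
  smooth : ∀ j : J, Order.IsSuccLimit j → Nonempty (IsColimit (coconeLT F j))
  ι : F ⟶ (Functor.const J).obj Y
  isColimit : IsColimit (Cocone.mk Y ι)
  fac : f = isoBot.inv ≫ ι.app ⊥

/-- The class of transfinite compositions of maps in `K`. -/
def transfiniteCompositions : MorphismProperty C :=
  fun _ _ f => ∃ (J : Type v) (hJ : WellOrderData J),
    letI := hJ
    Nonempty (TransfiniteCompositionOfShape K J f)

/-- The class of pushouts of maps in `K`. -/
def pushoutsOf : MorphismProperty C :=
  fun X Y f => ∃ (A B : C) (g : A ⟶ B) (u : A ⟶ X) (v : B ⟶ Y),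
    K g ∧ IsPushout u g f v

/-- Relative `K`-cell complexes: transfinite compositions of pushouts of maps
in `K`. -/
def relativeCellComplexes : MorphismProperty C :=
  transfiniteCompositions (pushoutsOf K)

/-- `K`-injective maps: maps with the right lifting property with respect to
all maps in `K`. -/
def rlp : MorphismProperty C :=
  fun _ _ p => ∀ ⦃A B : C⦄ (i : A ⟶ B), K i → HasLiftingProperty i p

/-- Maps with the left lifting property with respect to all maps in `K`.
`K`-cofibrations are the maps in `llp (rlp K)`. -/
def llp : MorphismProperty C :=
  fun _ _ i => ∀ ⦃A B : C⦄ (p : A ⟶ B), K p → HasLiftingProperty i p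

/-- A smooth `J`-indexed sequence with successor maps in `K`. -/
structure SmoothSequence (J : Type v) [WellOrderData J] where
  F : J ⥤ C
  step : ∀ j : J, ¬ IsMax j → K (F.map (homOfLE (Order.le_succ j)))
  smooth : ∀ j : J, Order.IsSuccLimit j → Nonempty (IsColimit (coconeLT F j))

/-- The object `A` is small relative to the class of maps `K` (Hovey,
Definition 2.1.3): there is a regular cardinal `κ` such that for every
`κ`-filtered well-ordered set `J` (i.e. one of cofinality `> κ`) and every
smooth `J`-indexed sequence with successor maps in `K` and colimit `c`, the
canonical map `colim_j C(A, F j) ⟶ C(A, c.pt)` is bijective (expressed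
concretely as: every map `A ⟶ c.pt` factors through some stage, and two
factorizations through a stage are identified at some later stage). -/
def IsSmallRel (A : C) : Prop :=
  ∃ κ : Cardinal.{v}, κ.IsRegular ∧
    ∀ (J : Type v) (hJ : WellOrderData J),
      letI := hJ
      κ < (Ordinal.type ((· < ·) : J → J → Prop)).cof →
      ∀ (S : SmoothSequence K J) (c : Cocone S.F), IsColimit c →
        (∀ g : A ⟶ c.pt, ∃ (j : J) (h : A ⟶ S.F.obj j), g = h ≫ c.ι.app j) ∧
        (∀ (j : J) (h h' : A ⟶ S.F.obj j), h ≫ c.ι.app j = h' ≫ c.ι.app j →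
          ∃ (k : J) (hk : j ≤ k),
            h ≫ S.F.map (homOfLE hk) = h' ≫ S.F.map (homOfLE hk))

/-- The class `K` is indexed by a set (i.e. a small family of maps). -/
def IsSetIndexed : Prop :=
  ∃ (ι : Type v) (A B : ι → C) (g : ∀ i, A i ⟶ B i),
    ∀ ⦃X Y : C⦄ (f : X ⟶ Y), K f ↔ ∃ i, Arrow.mk f = Arrow.mk (g i)

end TransfiniteComposition

/-- `M` is cofibrantly generated by the set `I` of generating cofibrations and
the set `Jg` of generating trivial cofibrations. -/
structure CofibrantlyGeneratedBy (M : ModelStructure C)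
    (I Jg : MorphismProperty C) : Prop where
  setI : IsSetIndexed I
  setJ : IsSetIndexed Jg
  smallI : ∀ ⦃A B : C⦄ (i : A ⟶ B), I i → IsSmallRel (relativeCellComplexes I) A
  smallJ : ∀ ⦃A B : C⦄ (i : A ⟶ B), Jg i → IsSmallRel (relativeCellComplexes Jg) A
  fib_eq : M.Fib = rlp Jg
  trivFib_eq : M.TrivFib = rlp I

end Muro

namespace Muro

variable {C : Type u} [Category.{v} C] [MonoidalCategory C] [HasInitial C]
  [HasPushouts C] [HasBinaryCoproducts C]

/-- `Ĩ = I ∪ {∅ ⟶ 𝟙}`. -/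
def tildeI (I : MorphismProperty C) : MorphismProperty C :=
  fun _ _ f => I f ∨ Arrow.mk f = Arrow.mk (initial.to (𝟙_ C))

/-- `J̃ = J ∪ {j ∘ i₁ : 𝟙̃ ⟶ C}` for a given map `ji₁ : 𝟙̃ ⟶ C`. -/
def tildeJ (Jg : MorphismProperty C) {T Cob : C} (ji₁ : T ⟶ Cob) :
    MorphismProperty C :=
  fun _ _ f => Jg f ∨ Arrow.mk f = Arrow.mk ji₁

/-- The Setup of the paper: `M` is a cofibrantly generated monoidal model
category satisfying the very strong unit axiom for a cofibrant resolution
`q : 𝟙̃ ⟶ 𝟙`, with generating cofibrations `I` and generating trivial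
cofibrations `Jg`; a factorization `𝟙̃ ⊔ 𝟙 —j→ C —p→ 𝟙` of `(q, id)` into a
cofibration followed by a weak equivalence is fixed; the domains of `I` are
small relative to relative `Ĩ`-cell complexes, and the domains of `Jg` are
small relative to relative `J̃`-cell complexes, where `Ĩ = I ∪ {∅ ⟶ 𝟙}` and
`J̃ = Jg ∪ {j ∘ i₁}`. -/
structure Setup (C : Type u) [Category.{v} C] [MonoidalCategory C]
    [HasInitial C] [HasPushouts C] [HasBinaryCoproducts C] where
  M : ModelStructure C
  ppAxiom : PushoutProductAxiom M
  unitAxiom : UnitAxiom M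
  I : MorphismProperty C
  Jg : MorphismProperty C
  cofGen : CofibrantlyGeneratedBy M I Jg
  T : C
  q : T ⟶ 𝟙_ C
  resolution : IsCofibrantResolutionOfUnit M q
  vsua : VeryStrongUnitAxiom M q
  Cob : C
  j : T ⨿ 𝟙_ C ⟶ Cob
  p : Cob ⟶ 𝟙_ C
  cof_j : M.Cof j
  weq_p : M.W p
  factorization : j ≫ p = coprod.desc q (𝟙 (𝟙_ C))
  smallI : ∀ ⦃A B : C⦄ (i : A ⟶ B), I i →
    IsSmallRel (relativeCellComplexes (tildeI I)) A
  smallJ : ∀ ⦃A B : C⦄ (i : A ⟶ B), Jg i →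
    IsSmallRel (relativeCellComplexes
      (tildeJ Jg ((coprod.inl : T ⟶ T ⨿ 𝟙_ C) ≫ j))) A

/-- The map `j ∘ i₁ : 𝟙̃ ⟶ C` of the Setup. -/
noncomputable def Setup.ji₁ (S : Setup C) : S.T ⟶ S.Cob :=
  (coprod.inl : S.T ⟶ S.T ⨿ 𝟙_ C) ≫ S.j

/-- The set `Ĩ` of the Setup. -/
def Setup.tI (S : Setup C) : MorphismProperty C := tildeI S.I

/-- The set `J̃` of the Setup. -/
noncomputable def Setup.tJ (S : Setup C) : MorphismProperty C := tildeJ S.Jg S.ji₁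

/-- `Mt` is the model structure `M̃` of the paper associated with the Setup
`S`: it has the same weak equivalences as `M`, it is generated by `Ĩ` and `J̃`,
i.e. its trivial fibrations are the `Ĩ`-injective maps, its fibrations are the
`J̃`-injective maps, and its cofibrations are the `Ĩ`-cofibrations. -/
structure Setup.IsTildeModel (S : Setup C) (Mt : ModelStructure C) : Prop where
  weq_eq : Mt.W = S.M.W
  trivFib_eq : Mt.TrivFib = rlp S.tI
  fib_eq : Mt.Fib = rlp S.tJ
  cof_eq : Mt.Cof = llp (rlp S.tI)

end Muro

namespace Muro

variable {C : Type u} [Category.{v} C]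

/-- Right properness: weak equivalences are preserved by pullback along
fibrations. -/
def RightProper (M : ModelStructure C) : Prop :=
  ∀ ⦃P X Z Y : C⦄ (fst : P ⟶ X) (snd : P ⟶ Z) (f : X ⟶ Y) (g : Z ⟶ Y),
    M.W f → M.Fib g → IsPullback fst snd f g → M.W snd

/-- Left properness: weak equivalences are preserved by pushout along
cofibrations. -/
def LeftProper (M : ModelStructure C) : Prop :=
  ∀ ⦃X Y Z P : C⦄ (f : X ⟶ Y) (g : X ⟶ Z) (inl : Y ⟶ P) (inr : Z ⟶ P),
    M.W f → M.Cof g → IsPushout f g inl inr → M.W inr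

section Monoidal

variable [MonoidalCategory C]

/-- The class of maps of the form `t ⊗ Z` with `t` a trivial cofibration and
`Z` any object. -/
def tensorTrivCofMaps (M : ModelStructure C) : MorphismProperty C :=
  fun _ _ g => ∃ (A B Z : C) (t : A ⟶ B), M.Cof t ∧ M.W t ∧
    Arrow.mk g = Arrow.mk (t ▷ Z)

/-- The monoid axiom: every transfinite composition of pushouts of maps of the
form `t ⊗ Z`, with `t` a trivial cofibration and `Z` any object, is a weak
equivalence. -/
def MonoidAxiom (M : ModelStructure C) : Prop :=
  ∀ ⦃X Y : C⦄ (f : X ⟶ Y),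
    transfiniteCompositions (pushoutsOf (tensorTrivCofMaps M)) f → M.W f

/-- An object `A` is cofibrant mod `𝟙` if it is a retract of an object `X`
admitting a cofibration `𝟙^(S) ⟶ X` from a coproduct of copies of the tensor
unit indexed by some (possibly empty) set `S`. -/
def CofibrantModOne [HasCoproducts.{v} C] (M : ModelStructure C) (A : C) : Prop :=
  ∃ (X : C) (i : A ⟶ X) (r : X ⟶ A), i ≫ r = 𝟙 A ∧
    ∃ (S : Type v) (c : (∐ fun _ : S => 𝟙_ C) ⟶ X), M.Cof c

/-- Pseudo-cofibrations: maps `f` such that `f ⊙ g` and `g ⊙ f` are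
cofibrations for every cofibration `g`, and trivial cofibrations for every
trivial cofibration `g`. -/
def PseudoCofibrations [HasPushouts C] (M : ModelStructure C) :
    MorphismProperty C :=
  fun _ _ f =>
    (∀ ⦃U V : C⦄ (g : U ⟶ V), M.Cof g →
      M.Cof (pushoutProduct f g) ∧ M.Cof (pushoutProduct g f)) ∧
    (∀ ⦃U V : C⦄ (g : U ⟶ V), M.Cof g → M.W g →
      (M.Cof (pushoutProduct f g) ∧ M.W (pushoutProduct f g)) ∧
      (M.Cof (pushoutProduct g f) ∧ M.W (pushoutProduct g f)))

end Monoidal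

end Muro

namespace Muro

variable {C : Type u} [Category.{v} C]

/-- Two maps `f g : A ⟶ X` are homotopic in `M` if they extend to a common map
from a cylinder of `A`. -/
def HomotopicMaps [HasBinaryCoproducts C] (M : ModelStructure C) {A X : C}
    (f g : A ⟶ X) : Prop :=
  ∃ (Z : C) (ins : A ⨿ A ⟶ Z) (wz : Z ⟶ A) (H : Z ⟶ X),
    M.Cof ins ∧ M.W wz ∧ ins ≫ wz = coprod.desc (𝟙 A) (𝟙 A) ∧
    coprod.inl ≫ ins ≫ H = f ∧ coprod.inr ≫ ins ≫ H = g

attribute [local simp] coprod.inl_desc coprod.inr_desc coprod.inl_desc_assoc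
  coprod.inr_desc_assoc

namespace ModelStructure

variable (M : ModelStructure C)

lemma cof_of_hasLiftingProperty {A B : C} (f : A ⟶ B)
    (hf : ∀ ⦃X Y : C⦄ (p : X ⟶ Y), M.Fib p → M.W p → HasLiftingProperty f p) : M.Cof f := by
  obtain ⟨Z, i, p, hi, hp, hpw, fac⟩ := M.factor_cof_trivFib f
  have := hf p hp hpw
  have sq : CommSq i f p (𝟙 B) := ⟨by simp [fac]⟩
  refine M.Cof_retract f i ⟨⟨𝟙 A, 𝟙 A, sq.lift, p, ?_, ?_, ?_, ?_⟩⟩ hi <;> simp [fac]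

lemma trivCof_of_hasLiftingProperty {A B : C} (f : A ⟶ B)
    (hf : ∀ ⦃X Y : C⦄ (p : X ⟶ Y), M.Fib p → HasLiftingProperty f p) : M.Cof f ∧ M.W f := by
  refine ⟨M.cof_of_hasLiftingProperty f fun _ _ p hp _ => hf p hp, ?_⟩
  obtain ⟨Z, i, p, hi, hiw, hp, fac⟩ := M.factor_trivCof_fib f
  have := hf p hp
  have sq : CommSq i f p (𝟙 B) := ⟨by simp [fac]⟩
  refine M.W_retract f i ⟨⟨𝟙 A, 𝟙 A, sq.lift, p, ?_, ?_, ?_, ?_⟩⟩ hiw <;> simp [fac]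

lemma cof_of_isPushout {A B A' B' : C} {f : A ⟶ A'} {g : A ⟶ B} {f' : B ⟶ B'} {g' : A' ⟶ B'}
    (sq : IsPushout f g g' f') (hf : M.Cof f) : M.Cof f' :=
  M.cof_of_hasLiftingProperty f' fun _ _ p hp hpw => by
    have := M.lift_cof_trivFib f p hf hp hpw
    exact sq.flip.hasLiftingProperty p

lemma trivCof_of_isPushout {A B A' B' : C} {f : A ⟶ A'} {g : A ⟶ B} {f' : B ⟶ B'} {g' : A' ⟶ B'}
    (sq : IsPushout f g g' f') (hf : M.Cof f) (hfw : M.W f) : M.Cof f' ∧ M.W f' :=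
  M.trivCof_of_hasLiftingProperty f' fun _ _ p hp => by
    have := M.lift_trivCof_fib f p hf hfw hp
    exact sq.flip.hasLiftingProperty p

lemma cof_comp {A B D : C} {f : A ⟶ B} {g : B ⟶ D} (hf : M.Cof f) (hg : M.Cof g) :
    M.Cof (f ≫ g) :=
  M.cof_of_hasLiftingProperty _ fun _ _ p hp hpw => by
    have := M.lift_cof_trivFib f p hf hp hpw
    have := M.lift_cof_trivFib g p hg hp hpw
    infer_instance

lemma Fibrant.exists_extension [HasTerminal C] {M : ModelStructure C} {X : C}
    (hX : M.Fibrant X) {A B : C} {i : A ⟶ B} (hi : M.Cof i) (hiw : M.W i) (f : A ⟶ X) :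
    ∃ g : B ⟶ X, i ≫ g = f := by
  have := M.lift_trivCof_fib i (terminal.from X) hi hiw hX
  have sq : CommSq f i (terminal.from X) (terminal.from B) := ⟨Subsingleton.elim _ _⟩
  exact ⟨sq.lift, sq.fac_left⟩

section BinaryCoproducts

variable [HasBinaryCoproducts C]

lemma cof_inl [HasInitial C] {A B : C} (hB : M.Cofibrant B) :
    M.Cof (coprod.inl : A ⟶ A ⨿ B) :=
  M.cof_of_hasLiftingProperty _ fun E _ p hp hpw => by
    have := M.lift_cof_trivFib _ p hB hp hpw
    refine ⟨fun {f g} sq => ?_⟩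
    have sq' : CommSq (initial.to E) (initial.to B) p (coprod.inr ≫ g) :=
      ⟨Subsingleton.elim _ _⟩
    exact ⟨⟨⟨coprod.desc f sq'.lift, by simp, by ext <;> simp [sq.w]⟩⟩⟩

lemma cof_inr [HasInitial C] {A B : C} (hA : M.Cofibrant A) :
    M.Cof (coprod.inr : B ⟶ A ⨿ B) :=
  M.cof_of_hasLiftingProperty _ fun E _ p hp hpw => by
    have := M.lift_cof_trivFib _ p hA hp hpw
    refine ⟨fun {f g} sq => ?_⟩
    have sq' : CommSq (initial.to E) (initial.to A) p (coprod.inl ≫ g) :=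
      ⟨Subsingleton.elim _ _⟩
    exact ⟨⟨⟨coprod.desc sq'.lift f, by simp, by ext <;> simp [sq.w]⟩⟩⟩

lemma trivCof_coprod_map {A B A' B' : C} {f : A ⟶ B} {f' : A' ⟶ B'}
    (hf : M.Cof f) (hfw : M.W f) (hf' : M.Cof f') (hfw' : M.W f') :
    M.Cof (coprod.map f f') ∧ M.W (coprod.map f f') :=
  M.trivCof_of_hasLiftingProperty _ fun _ _ p hp => by
    have := M.lift_trivCof_fib f p hf hfw hp
    have := M.lift_trivCof_fib f' p hf' hfw' hp
    refine ⟨fun {a b} sq => ?_⟩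
    have sq₁ : CommSq (coprod.inl ≫ a) f p (coprod.inl ≫ b) := ⟨by simp [sq.w]⟩
    have sq₂ : CommSq (coprod.inr ≫ a) f' p (coprod.inr ≫ b) := ⟨by simp [sq.w]⟩
    exact ⟨⟨⟨coprod.desc sq₁.lift sq₂.lift, by ext <;> simp, by ext <;> simp⟩⟩⟩

end BinaryCoproducts

end ModelStructure

section Homotopy

variable [HasBinaryCoproducts C] {M : ModelStructure C}

/-- The cylinder of a homotopy into a fibrant object can be chosen to be trivially fibrant
over its base. -/
lemma HomotopicMaps.exists_trivFib [HasTerminal C] {A X : C} {f g : A ⟶ X}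
    (h : HomotopicMaps M f g) (hX : M.Fibrant X) :
    ∃ (Z : C) (ins : A ⨿ A ⟶ Z) (wz : Z ⟶ A) (H : Z ⟶ X), M.Fib wz ∧ M.W wz ∧
      ins ≫ wz = coprod.desc (𝟙 A) (𝟙 A) ∧ ins ≫ H = coprod.desc f g := by
  obtain ⟨Z, ins, wz, H, -, hwz, hfold, rfl, rfl⟩ := h
  obtain ⟨Z', i, p, hi, hiw, hp, rfl⟩ := M.factor_trivCof_fib wz
  obtain ⟨H', rfl⟩ := hX.exists_extension hi hiw H
  exact ⟨Z', ins ≫ i, p, H', hp, M.W_of_comp_left _ _ hiw hwz, by simpa using hfold,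
    by ext <;> simp⟩

/-- Homotopies into a fibrant object can be pulled back along `k : A ⟶ B` to any map
`wz : Z ⟶ A` with a cofibration `A ⨿ A ⟶ Z` factoring the fold map of `A`. -/
lemma HomotopicMaps.exists_precomp [HasTerminal C] {A B X : C} {f g : B ⟶ X}
    (h : HomotopicMaps M f g) (hX : M.Fibrant X) (k : A ⟶ B) {Z : C} {ins : A ⨿ A ⟶ Z}
    {wz : Z ⟶ A} (hins : M.Cof ins) (fold : ins ≫ wz = coprod.desc (𝟙 A) (𝟙 A)) :
    ∃ H : Z ⟶ X, coprod.inl ≫ ins ≫ H = k ≫ f ∧ coprod.inr ≫ ins ≫ H = k ≫ g := by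
  obtain ⟨Z', ins', wz', H, hp, hpw, fold', hH⟩ := h.exists_trivFib hX
  have := M.lift_cof_trivFib ins wz' hins hp hpw
  have sq : CommSq (coprod.map k k ≫ ins') ins wz' (wz ≫ k) :=
    ⟨by rw [Category.assoc, fold', reassoc_of% fold]; ext <;> simp⟩
  exact ⟨sq.lift ≫ H, by simp [hH], by simp [hH]⟩

lemma HomotopicMaps.precomp [HasTerminal C] {A B X : C} {f g : B ⟶ X}
    (h : HomotopicMaps M f g) (hX : M.Fibrant X) (k : A ⟶ B) :
    HomotopicMaps M (k ≫ f) (k ≫ g) := by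
  obtain ⟨Z, ins, wz, hins, -, hwz, fold⟩ :=
    M.factor_cof_trivFib (coprod.desc (𝟙 A) (𝟙 A))
  obtain ⟨H, h₁, h₂⟩ := h.exists_precomp hX k hins fold
  exact ⟨Z, ins, wz, H, hins, hwz, fold, h₁, h₂⟩

lemma HomotopicMaps.of_precomp_trivCof [HasPushouts C] {A B X : C} {k : A ⟶ B}
    (hk : M.Cof k) (hkw : M.W k) {f g : B ⟶ X} (h : HomotopicMaps M (k ≫ f) (k ≫ g)) :
    HomotopicMaps M f g := by
  obtain ⟨Z, ins, wz, H, hins, hwz, fold, hf, hg⟩ := h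
  obtain ⟨hkk, hkkw⟩ := M.trivCof_coprod_map hk hkw hk hkw
  have po := IsPushout.of_hasPushout ins (coprod.map k k)
  have wB : ins ≫ wz ≫ k = coprod.map k k ≫ coprod.desc (𝟙 B) (𝟙 B) := by
    rw [reassoc_of% fold]; ext <;> simp
  have wX : ins ≫ H = coprod.map k k ≫ coprod.desc f g := by
    ext <;> simp [hf, hg]
  refine ⟨_, pushout.inr ins (coprod.map k k), po.desc _ _ wB, po.desc _ _ wX,
    M.cof_of_isPushout po hins, ?_, by simp, by simp, by simp⟩
  refine M.W_of_comp_left (pushout.inl ins (coprod.map k k)) _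
    (M.trivCof_of_isPushout po.flip hkk hkkw).2 ?_
  rw [po.inl_desc]
  exact M.W_comp _ _ hwz hkw

/-- The property that every map `T ⟶ X` is homotopic to one factoring through `q : T ⟶ U`
is invariant under trivial cofibrations over `U`. -/
lemma forall_exists_homotopicMaps_iff_of_trivCof [HasTerminal C] [HasPushouts C]
    {T Z U X : C} (hX : M.Fibrant X) {k : T ⟶ Z} (hk : M.Cof k) (hkw : M.W k) (q : Z ⟶ U) :
    (∀ g : T ⟶ X, ∃ h : U ⟶ X, HomotopicMaps M g ((k ≫ q) ≫ h)) ↔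
      ∀ g : Z ⟶ X, ∃ h : U ⟶ X, HomotopicMaps M g (q ≫ h) := by
  refine ⟨fun H g => ?_, fun H g => ?_⟩
  · obtain ⟨h, hh⟩ := H (k ≫ g)
    rw [Category.assoc] at hh
    exact ⟨h, hh.of_precomp_trivCof hk hkw⟩
  · obtain ⟨g, rfl⟩ := hX.exists_extension hk hkw g
    obtain ⟨h, hh⟩ := H g
    exact ⟨h, by simpa using hh.precomp hX k⟩

/-- The property that every map `T ⟶ X` is homotopic to one factoring through `q : T ⟶ U`
does not depend on the choice of the cofibrant resolution `q` of `U`. -/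
lemma forall_exists_homotopicMaps_iff [HasInitial C] [HasTerminal C] [HasPushouts C]
    {T₁ T₂ U X : C} (hX : M.Fibrant X) {q₁ : T₁ ⟶ U} {q₂ : T₂ ⟶ U}
    (hT₁ : M.Cofibrant T₁) (hq₁ : M.W q₁) (hT₂ : M.Cofibrant T₂) (hq₂ : M.W q₂) :
    (∀ g : T₁ ⟶ X, ∃ h : U ⟶ X, HomotopicMaps M g (q₁ ≫ h)) ↔
      ∀ g : T₂ ⟶ X, ∃ h : U ⟶ X, HomotopicMaps M g (q₂ ≫ h) := by
  obtain ⟨Z, i, p, hi, -, hp, fac⟩ := M.factor_cof_trivFib (coprod.desc q₁ q₂)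
  obtain ⟨rfl, rfl⟩ : (coprod.inl ≫ i) ≫ p = q₁ ∧ (coprod.inr ≫ i) ≫ p = q₂ := by simp [fac]
  exact (forall_exists_homotopicMaps_iff_of_trivCof hX (M.cof_comp (M.cof_inl hT₂) hi)
    (M.W_of_comp_right _ _ hp hq₁) p).trans
    (forall_exists_homotopicMaps_iff_of_trivCof hX (M.cof_comp (M.cof_inr hT₁) hi)
      (M.W_of_comp_right _ _ hp hq₂) p).symm

end Homotopy

lemma hasLiftingProperty_terminal_from_iff [HasTerminal C] {A B : C} (i : A ⟶ B) (X : C) :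
    HasLiftingProperty i (terminal.from X) ↔ ∀ f : A ⟶ X, ∃ g : B ⟶ X, i ≫ g = f := by
  refine ⟨fun _ f => ?_, fun H => ⟨fun {f g} _ => ?_⟩⟩
  · have sq : CommSq f i (terminal.from X) (terminal.from B) := ⟨Subsingleton.elim _ _⟩
    exact ⟨sq.lift, sq.fac_left⟩
  · obtain ⟨l, hl⟩ := H f
    exact ⟨⟨⟨l, hl, Subsingleton.elim _ _⟩⟩⟩

lemma hasLiftingProperty_of_arrow_mk_eq {A B A' B' X Y : C} {i : A ⟶ B} {i' : A' ⟶ B'}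
    (h : Arrow.mk i = Arrow.mk i') (p : X ⟶ Y) [HasLiftingProperty i' p] :
    HasLiftingProperty i p :=
  HasLiftingProperty.of_arrow_iso_left (eqToIso h.symm) p

lemma rlp_tildeJ_iff (K : MorphismProperty C) {T D X Y : C} (i : T ⟶ D) (p : X ⟶ Y) :
    rlp (tildeJ K i) p ↔ rlp K p ∧ HasLiftingProperty i p := by
  refine ⟨fun H => ⟨fun _ _ f hf => H f (Or.inl hf), H i (Or.inr rfl)⟩, ?_⟩
  rintro ⟨H, _⟩ _ _ f (hf | hf)
  · exact H f hf
  · exact hasLiftingProperty_of_arrow_mk_eq hf p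

/-- **Remark of the paper.** Under the Setup, if the
factorization of `(q, id)` is obtained by choosing a cylinder
`j̄ = (j̄₁, j̄₂) : 𝟙̃ ⊔ 𝟙̃ ⟶ C̄` for `𝟙̃` in `M` and letting `C` be the pushout
of `j̄₂` along `q`, then an object `X` is fibrant in `M̃` if and only if it is
fibrant in `M` and every map `𝟙̃ ⟶ X` is homotopic in `M` to a map which
factors through `q : 𝟙̃ ⟶ 𝟙`.  Moreover, this factorization property holds
for one cofibrant resolution of the tensor unit if and only if it holds for
every cofibrant resolution. -/
theorem tilde_fibrant_iff {C : Type u} [Category.{v} C] [MonoidalCategory C]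
    [HasInitial C] [HasTerminal C] [HasPushouts C] [HasBinaryCoproducts C]
    (S : Setup C) (Mt : ModelStructure C) (hMt : S.IsTildeModel Mt)
    -- the cylinder `j̄ = (j̄₁, j̄₂) : 𝟙̃ ⊔ 𝟙̃ ⟶ C̄` for `𝟙̃` in `M`:
    (Cb : C) (jb : S.T ⨿ S.T ⟶ Cb) (w : Cb ⟶ S.T)
    (cof_jb : S.M.Cof jb) (weq_w : S.M.W w)
    (cyl : jb ≫ w = coprod.desc (𝟙 S.T) (𝟙 S.T))
    -- `C` is the pushout of `j̄₂ = coprod.inr ≫ j̄` along `q`: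
    (u : Cb ⟶ S.Cob) (v : 𝟙_ C ⟶ S.Cob)
    (po : IsPushout ((coprod.inr : S.T ⟶ S.T ⨿ S.T) ≫ jb) S.q u v)
    -- compatibility with the factorization `j`, `p` of the Setup:
    (hj : S.j = coprod.desc ((coprod.inl : S.T ⟶ S.T ⨿ S.T) ≫ jb ≫ u) v) :
    (∀ X : C, Mt.Fibrant X ↔
      (S.M.Fibrant X ∧ ∀ g : S.T ⟶ X, ∃ h : 𝟙_ C ⟶ X,
        HomotopicMaps S.M g (S.q ≫ h))) ∧
    (∀ X : C, S.M.Fibrant X →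
      ∀ (T₁ T₂ : C) (q₁ : T₁ ⟶ 𝟙_ C) (q₂ : T₂ ⟶ 𝟙_ C),
        IsCofibrantResolutionOfUnit S.M q₁ →
        IsCofibrantResolutionOfUnit S.M q₂ →
        ((∀ g : T₁ ⟶ X, ∃ h : 𝟙_ C ⟶ X, HomotopicMaps S.M g (q₁ ≫ h)) ↔
         (∀ g : T₂ ⟶ X, ∃ h : 𝟙_ C ⟶ X, HomotopicMaps S.M g (q₂ ≫ h)))) := by
  refine ⟨fun X => ?_, fun X hX T₁ T₂ q₁ q₂ h₁ h₂ =>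
    forall_exists_homotopicMaps_iff hX h₁.1 h₁.2 h₂.1 h₂.2⟩
  have hji₁ : S.ji₁ = coprod.inl ≫ jb ≫ u := by simp [Setup.ji₁, hj]
  simp only [ModelStructure.Fibrant, hMt.fib_eq, S.cofGen.fib_eq, Setup.tJ, rlp_tildeJ_iff]
  refine and_congr_right fun hX => ?_
  replace hX : S.M.Fibrant X := by rwa [ModelStructure.Fibrant, S.cofGen.fib_eq]
  rw [hasLiftingProperty_terminal_from_iff, hji₁]
  refine forall_congr' fun g => ⟨?_, ?_⟩
  · rintro ⟨H, rfl⟩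
    exact ⟨v ≫ H, Cb, jb, w, u ≫ H, cof_jb, weq_w, cyl, by simp, by simpa using po.w_assoc H⟩
  · rintro ⟨h, hh⟩
    obtain ⟨H, h₁, h₂⟩ := hh.exists_precomp hX (𝟙 _) cof_jb cyl
    refine ⟨po.desc H h (by simpa using h₂), by simpa using h₁⟩

end Muro
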